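/- Let Γ ⊂ P^n be a nondegenerate finite subscheme of degree d in linearly general position over an algebraically closed field of characteristic 0 with ⌈(d−1)/(n + n/(2n+2))⌉ + 3 ≤ reg(Γ). Let Q ⊂ P^n be a quadric hypersurface such that |Q ∩ Γ| ≥ 2n+1 and reg(Γ ∩ Q) < reg(Γ). Then ⌈(|Γ : Q| − 1)/(n + n/(2n+2))⌉ + 3 ≤ reg(Γ : Q). -/

import Mathlib

open MvPolynomial Filter
open scoped Classical

attribute [local instance] MvPolynomial.gradedAlgebra

noncomputable section

variable {K : Type} [Field K] {n : ℕ}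

/-- The Hilbert function, in degree `m`, of the quotient of the homogeneous
coordinate ring of `ℙ^n_K` by the ideal `I`. -/
def hilbF (I : Ideal (MvPolynomial (Fin (n+1)) K)) (m : ℕ) : ℕ :=
  Module.finrank K
    ((MvPolynomial.homogeneousSubmodule (Fin (n+1)) K m).map
      (Ideal.Quotient.mkₐ K I).toLinearMap)

/-- The irrelevant maximal ideal `(x_0, …, x_n)`. -/
def irrelevantIdeal (K : Type) [Field K] (n : ℕ) : Ideal (MvPolynomial (Fin (n+1)) K) :=
  Ideal.span (Set.range MvPolynomial.X)

/-- Saturation of a homogeneous ideal with respect to the irrelevant ideal. -/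
def saturate (I : Ideal (MvPolynomial (Fin (n+1)) K)) : Ideal (MvPolynomial (Fin (n+1)) K) :=
  ⨆ k : ℕ, Submodule.colon I ((irrelevantIdeal K n ^ k : Ideal (MvPolynomial (Fin (n+1)) K)) : Submodule (MvPolynomial (Fin (n+1)) K) (MvPolynomial (Fin (n+1)) K))

/-- `I` is the (saturated, homogeneous) ideal of a nonempty finite closed subscheme of
`ℙ^n`, i.e. its Hilbert function is eventually a positive constant. -/
structure IsFiniteSubscheme (I : Ideal (MvPolynomial (Fin (n+1)) K)) : Prop where
  homog : Ideal.IsHomogeneous (MvPolynomial.homogeneousSubmodule (Fin (n+1)) K) I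
  saturated : saturate I = I
  finite : ∃ d : ℕ, 0 < d ∧ ∀ᶠ m : ℕ in atTop, hilbF I m = d

/-- The degree (length) of the finite scheme with ideal `I` : the eventual value of
its Hilbert function. -/
def schemeDeg (I : Ideal (MvPolynomial (Fin (n+1)) K)) : ℕ :=
  if h : ∃ d : ℕ, ∀ᶠ m : ℕ in atTop, hilbF I m = d then h.choose else 0

/-- The Castelnuovo–Mumford regularity of the finite scheme with ideal `I` : the least
`p ≥ 1` such that the scheme is `(p-1)`-normal (for a finite scheme, `p`-regularity is
equivalent to `(p-1)`-normality). -/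
def schemeReg (I : Ideal (MvPolynomial (Fin (n+1)) K)) : ℕ :=
  sInf {p : ℕ | 1 ≤ p ∧ ∀ m : ℕ, p - 1 ≤ m → hilbF I m = schemeDeg I}

/-- `h¹(ℙ^n, I_Γ(q))` for a finite scheme `Γ` and `q ≥ 0`: the failure of `q`-normality,
`deg Γ - h_Γ(q)`. -/
def h1F (I : Ideal (MvPolynomial (Fin (n+1)) K)) (q : ℕ) : ℕ :=
  schemeDeg I - hilbF I q

/-- `J` is the ideal of a `t`-dimensional linear subspace of `ℙ^n`: it is generated by a
space of linear forms of codimension... i.e. of `K`-dimension `n - t`. -/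
def IsLinearSubspace (J : Ideal (MvPolynomial (Fin (n+1)) K)) (t : ℕ) : Prop :=
  ∃ W : Submodule K (MvPolynomial (Fin (n+1)) K),
    W ≤ MvPolynomial.homogeneousSubmodule (Fin (n+1)) K 1 ∧
    Module.finrank K W + t = n ∧
    J = Ideal.span (W : Set (MvPolynomial (Fin (n+1)) K))

/-- The ideal of the scheme-theoretic intersection (defined by the sum of the ideal
sheaves): the saturation of `I + J`. -/
def interIdeal (I J : Ideal (MvPolynomial (Fin (n+1)) K)) : Ideal (MvPolynomial (Fin (n+1)) K) :=
  saturate (I ⊔ J)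

/-- The residual scheme `Γ : V`, where `V` is the hypersurface `{f = 0}`, is defined by
the colon ideal `(I_Γ : f)`. -/
def residualIdeal (I : Ideal (MvPolynomial (Fin (n+1)) K)) (f : MvPolynomial (Fin (n+1)) K) :
    Ideal (MvPolynomial (Fin (n+1)) K) :=
  Submodule.colon I (Ideal.span {f})

/-- `Γ` admits a `(t+2)`-secant `t`-plane. -/
def HasSecantPlane (I : Ideal (MvPolynomial (Fin (n+1)) K)) (t : ℕ) : Prop :=
  ∃ J : Ideal (MvPolynomial (Fin (n+1)) K),
    IsLinearSubspace J t ∧ t + 2 ≤ schemeDeg (interIdeal I J)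

/-- `t(Γ)`: the smallest `t` such that `Γ` admits a `(t+2)`-secant `t`-plane. -/
def tInv (I : Ideal (MvPolynomial (Fin (n+1)) K)) : ℕ :=
  sInf {t : ℕ | HasSecantPlane I t}

/-- `Γ` is in linearly general position if `t(Γ) = n`. -/
def InLinGenPos (I : Ideal (MvPolynomial (Fin (n+1)) K)) : Prop :=
  tInv I = n

/-- `Γ ⊆ ℙ^n` is nondegenerate: `I(Γ)` contains no nonzero linear form. -/
def NondegenerateScheme (I : Ideal (MvPolynomial (Fin (n+1)) K)) : Prop :=
  Submodule.restrictScalars K I ⊓ MvPolynomial.homogeneousSubmodule (Fin (n+1)) K 1 = ⊥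

/-- The (projective) dimension of the linear span `⟨Γ⟩` of the scheme with ideal `I`:
`n` minus the number of independent linear forms in `I`. -/
def spanDim (I : Ideal (MvPolynomial (Fin (n+1)) K)) : ℕ :=
  n - Module.finrank K
    ↥(Submodule.restrictScalars K I ⊓ MvPolynomial.homogeneousSubmodule (Fin (n+1)) K 1)

/-- `Γ ∩ Λ` is nondegenerate as a subscheme of the `t`-plane `Λ`: it is contained in no
`(t-1)`-dimensional linear subspace of `Λ`. -/
def NondegenerateIn (I Λ : Ideal (MvPolynomial (Fin (n+1)) K)) (t : ℕ) : Prop :=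
  ∀ J : Ideal (MvPolynomial (Fin (n+1)) K),
    IsLinearSubspace J (t - 1) → Λ ≤ J → ¬ J ≤ interIdeal I Λ

/-- `Γ ∩ Λ` is in linearly general position as a subscheme of the `t`-plane `Λ`: it has
no `(s+2)`-secant `s`-plane inside `Λ` for any `s < t`. -/
def InLinGenPosIn (I Λ : Ideal (MvPolynomial (Fin (n+1)) K)) (t : ℕ) : Prop :=
  ∀ s : ℕ, s < t → ∀ J : Ideal (MvPolynomial (Fin (n+1)) K),
    IsLinearSubspace J s → Λ ≤ J → schemeDeg (interIdeal I J) ≤ s + 1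

/-- `J` is the (saturated) homogeneous ideal of a rational normal curve of degree `t`
in `ℙ^n` : the curve is the image of `ℙ^1` under a parametrization by a basis-spanning
family of binary forms of degree `t`, and `J` is the vanishing ideal of (the affine cone
over) this image. -/
def IsRNC (t : ℕ) (J : Ideal (MvPolynomial (Fin (n+1)) K)) : Prop :=
  ∃ p : Fin (n+1) → MvPolynomial (Fin 2) K,
    (∀ i, (p i).IsHomogeneous t) ∧
    Submodule.span K (Set.range p) = MvPolynomial.homogeneousSubmodule (Fin 2) K t ∧
    J = ⨅ x : Fin 2 → K,
      RingHom.ker (MvPolynomial.eval (fun i => MvPolynomial.eval x (p i)) :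
        MvPolynomial (Fin (n+1)) K →+* K)

/-- `ρ(Γ)`: the maximal length of the intersection of `Γ` with a rational normal curve
(of degree `n`) in `ℙ^n`. -/
def rhoInv (I : Ideal (MvPolynomial (Fin (n+1)) K)) : ℕ :=
  sSup {e : ℕ | ∃ J : Ideal (MvPolynomial (Fin (n+1)) K),
    IsRNC n J ∧ e = schemeDeg (interIdeal I J)}

/-- The (saturated homogeneous) vanishing ideal of a point of `ℙ^n`. -/
def pointIdeal (P : Projectivization K (Fin (n+1) → K)) : Ideal (MvPolynomial (Fin (n+1)) K) :=
  ⨅ c : K, RingHom.ker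
    (MvPolynomial.eval (c • P.rep) : MvPolynomial (Fin (n+1)) K →+* K)

/-- The vanishing ideal of a finite set of points of `ℙ^n`. -/
def idealOfFinset (S : Finset (Projectivization K (Fin (n+1) → K))) :
    Ideal (MvPolynomial (Fin (n+1)) K) :=
  ⨅ P ∈ S, pointIdeal P

/-- A finite set of points of `ℙ^n` is in uniform position if every subset `Y` has
Hilbert function `h_Y(ℓ) = min {|Y|, h_Γ(ℓ)}`. -/
def UniformPosition (S : Finset (Projectivization K (Fin (n+1) → K))) : Prop :=
  ∀ Y ⊆ S, ∀ ℓ : ℕ, hilbF (idealOfFinset Y) ℓ = min Y.card (hilbF (idealOfFinset S) ℓ)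

end

section HilbertFunction

variable {K : Type} [Field K] {n : ℕ}

instance finite_homogeneousSubmodule (m : ℕ) :
    Module.Finite K (homogeneousSubmodule (Fin (n + 1)) K m) :=
  Module.Finite.iff_fg.2 (homogeneousSubmodule_fg _ _ m)

lemma finrank_map_of_injective {V W : Type*} [AddCommGroup V] [Module K V] [AddCommGroup W]
    [Module K W] {g : V →ₗ[K] W} (hg : Function.Injective g) (p : Submodule K V) :
    Module.finrank K (p.map g) = Module.finrank K p :=
  (Submodule.equivMapOfInjective g hg p).finrank_eq.symm

/-- The degree `m` part of an ideal. -/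
noncomputable def gradedPart (I : Ideal (MvPolynomial (Fin (n + 1)) K)) (m : ℕ) :
    Submodule K (MvPolynomial (Fin (n + 1)) K) :=
  homogeneousSubmodule (Fin (n + 1)) K m ⊓ I.restrictScalars K

instance finite_gradedPart (I : Ideal (MvPolynomial (Fin (n + 1)) K)) (m : ℕ) :
    Module.Finite K (gradedPart I m) :=
  Submodule.finiteDimensional_of_le (inf_le_left :
    gradedPart I m ≤ homogeneousSubmodule (Fin (n + 1)) K m)

lemma hilbF_add_finrank_gradedPart (I : Ideal (MvPolynomial (Fin (n + 1)) K)) (m : ℕ) :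
    hilbF I m + Module.finrank K (gradedPart I m) =
      Module.finrank K (homogeneousSubmodule (Fin (n + 1)) K m) := by
  have h := LinearMap.finrank_range_add_finrank_ker
    ((Ideal.Quotient.mkₐ K I).toLinearMap.domRestrict (homogeneousSubmodule (Fin (n + 1)) K m))
  rw [LinearMap.range_domRestrict, LinearMap.ker_domRestrict] at h
  rw [← h, hilbF]
  congr 1
  rw [← finrank_map_of_injective (Submodule.injective_subtype _) (Submodule.comap _ _),
    Submodule.map_comap_subtype]
  have hker : (Ideal.Quotient.mkₐ K I).toLinearMap.ker = I.restrictScalars K := by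
    ext x
    exact Ideal.Quotient.eq_zero_iff_mem
  rw [hker, gradedPart]

lemma hilbF_le_finrank (I : Ideal (MvPolynomial (Fin (n + 1)) K)) (m : ℕ) :
    hilbF I m ≤ Module.finrank K (homogeneousSubmodule (Fin (n + 1)) K m) :=
  (Nat.le_add_right _ _).trans_eq (hilbF_add_finrank_gradedPart I m)

lemma hilbF_anti {I J : Ideal (MvPolynomial (Fin (n + 1)) K)} (h : I ≤ J) (m : ℕ) :
    hilbF J m ≤ hilbF I m := by
  have hI := hilbF_add_finrank_gradedPart I m
  have hJ := hilbF_add_finrank_gradedPart J m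
  have : Module.finrank K (gradedPart I m) ≤ Module.finrank K (gradedPart J m) :=
    Submodule.finrank_mono (inf_le_inf_left _ h)
  omega

lemma hilbF_one_le (I : Ideal (MvPolynomial (Fin (n + 1)) K)) : hilbF I 1 ≤ n + 1 := by
  refine (hilbF_le_finrank I 1).trans ?_
  rw [homogeneousSubmodule_one_eq_span_X]
  exact (finrank_range_le_card _).trans_eq (Fintype.card_fin _)

lemma hilbF_le_one (I : Ideal (MvPolynomial (Fin (0 + 1)) K)) (m : ℕ) : hilbF I m ≤ 1 := by
  refine (hilbF_le_finrank I m).trans ?_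
  have hle : homogeneousSubmodule (Fin (0 + 1)) K m ≤
      Submodule.span K {monomial (Finsupp.single 0 m) 1} := by
    intro φ hφ
    refine Submodule.mem_span_singleton.2 ⟨coeff (Finsupp.single 0 m) φ, ?_⟩
    rw [mem_homogeneousSubmodule] at hφ
    ext e
    have he : e = Finsupp.single 0 (e 0) := by
      ext i
      rw [show i = 0 from Fin.ext (by omega), Finsupp.single_eq_same]
    rw [coeff_smul, coeff_monomial]
    split_ifs with h
    · rw [h, smul_eq_mul, mul_one]
    · rw [smul_zero, hφ.coeff_eq_zero]
      intro hd
      apply h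
      rw [he, Finsupp.degree_single] at hd
      rw [he, hd]
  exact (Submodule.finrank_mono hle).trans ((finrank_span_le_card _).trans (by simp))

lemma homogeneousComponent_mul_of_isHomogeneous {f : MvPolynomial (Fin (n + 1)) K} {k : ℕ}
    (hf : f.IsHomogeneous k) (b : MvPolynomial (Fin (n + 1)) K) (m : ℕ) :
    homogeneousComponent (m + k) (b * f) = homogeneousComponent m b * f := by
  have h := DirectSum.coe_decompose_mul_of_right_mem_of_le
    (homogeneousSubmodule (Fin (n + 1)) K) (a := b) (b := f) hf (Nat.le_add_left k m)
  rw [Nat.add_sub_cancel] at h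
  rw [← decomposition.decompose'_apply, ← decomposition.decompose'_apply]
  exact h

/-- Additivity of the Hilbert function along
`0 → S/(I : f)(-k) → S/I → S/(I + f) → 0`. -/
lemma hilbF_residualIdeal_add {I : Ideal (MvPolynomial (Fin (n + 1)) K)}
    (hI : I.IsHomogeneous (homogeneousSubmodule (Fin (n + 1)) K))
    {f : MvPolynomial (Fin (n + 1)) K} (hf0 : f ≠ 0) {k : ℕ} (hf : f.IsHomogeneous k) (m : ℕ) :
    hilbF (residualIdeal I f) m + hilbF (I ⊔ Ideal.span {f}) (m + k) = hilbF I (m + k) := by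
  let μ := LinearMap.mulRight K f
  have hμ : Function.Injective μ := mul_left_injective₀ hf0
  let V := (homogeneousSubmodule (Fin (n + 1)) K m).map μ
  have hsup : gradedPart (I ⊔ Ideal.span {f}) (m + k) = gradedPart I (m + k) ⊔ V := by
    apply le_antisymm
    · rintro x ⟨hx, hxI⟩
      obtain ⟨a, ha, c, hc, rfl⟩ := Submodule.mem_sup.1 hxI
      obtain ⟨b, rfl⟩ := Ideal.mem_span_singleton'.1 hc
      rw [← homogeneousComponent_eq_self hx, map_add,
        homogeneousComponent_mul_of_isHomogeneous hf]
      exact Submodule.add_mem_sup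
        ⟨homogeneousComponent_mem _ _, homogeneousComponent_mem_of_mem hI ha _⟩
        ⟨_, homogeneousComponent_mem _ _, rfl⟩
    · refine sup_le (inf_le_inf_left _ fun x hx => Ideal.mem_sup_left hx) ?_
      rintro _ ⟨b, hb, rfl⟩
      exact ⟨IsHomogeneous.mul hb hf,
        Ideal.mem_sup_right (Ideal.mem_span_singleton'.2 ⟨b, rfl⟩)⟩
  have hinf : gradedPart I (m + k) ⊓ V = (gradedPart (residualIdeal I f) m).map μ := by
    ext x
    constructor
    · rintro ⟨⟨-, hx⟩, b, hb, rfl⟩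
      exact ⟨b, ⟨hb, Ideal.mem_colon_span_singleton.2 hx⟩, rfl⟩
    · rintro ⟨b, ⟨hb, hbI⟩, rfl⟩
      exact ⟨⟨IsHomogeneous.mul hb hf, Ideal.mem_colon_span_singleton.1 hbI⟩, b, hb, rfl⟩
  have hdim := Submodule.finrank_sup_add_finrank_inf_eq (gradedPart I (m + k)) V
  rw [← hsup, hinf, finrank_map_of_injective hμ,
    finrank_map_of_injective hμ] at hdim
  have h1 := hilbF_add_finrank_gradedPart I (m + k)
  have h2 := hilbF_add_finrank_gradedPart (I ⊔ Ideal.span {f}) (m + k)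
  have h3 := hilbF_add_finrank_gradedPart (residualIdeal I f) m
  omega

lemma le_saturate (I : Ideal (MvPolynomial (Fin (n + 1)) K)) : I ≤ saturate I :=
  le_iSup_of_le 0 Ideal.le_colon

/-- A saturated ideal admits a linear form which is a nonzerodivisor modulo it. -/
lemma exists_linear_nonzerodivisor [Infinite K] {I : Ideal (MvPolynomial (Fin (n + 1)) K)}
    (hI : saturate I = I) : ∃ l : MvPolynomial (Fin (n + 1)) K, l.IsHomogeneous 1 ∧
      ∀ x, x * l ∈ I → x ∈ I := by
  let R := MvPolynomial (Fin (n + 1)) K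
  let E := homogeneousSubmodule (Fin (n + 1)) K 1
  have hproper : ∀ P ∈ associatedPrimes R (R ⧸ I),
      (P.restrictScalars K).comap E.subtype ≠ ⊤ := by
    intro P hP htop
    obtain ⟨hprime, y, rfl⟩ := isAssociatedPrime_iff.1 hP
    obtain ⟨x, rfl⟩ := Ideal.Quotient.mk_surjective y
    have hX : irrelevantIdeal K n ≤ Submodule.colon ⊥ {Ideal.Quotient.mk I x} := by
      refine Ideal.span_le.2 ?_
      rintro _ ⟨i, rfl⟩
      have : (⟨X i, isHomogeneous_X K i⟩ : E) ∈
          ((Submodule.colon ⊥ {Ideal.Quotient.mk I x}).restrictScalars K).comap E.subtype :=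
        htop ▸ Submodule.mem_top
      exact this
    have hx : x ∈ I := by
      rw [← hI]
      refine Submodule.mem_iSup_of_mem 1 (Submodule.mem_colon.2 fun r hr => ?_)
      rw [pow_one] at hr
      have := Submodule.mem_colon_singleton.1 (hX hr)
      rw [smul_eq_mul, mul_comm]
      exact Ideal.Quotient.eq_zero_iff_mem.1 this
    refine hprime.ne_top ?_
    rw [Ideal.Quotient.eq_zero_iff_mem.2 hx, Submodule.colon_singleton_zero]
  have hfin := associatedPrimes.finite R (R ⧸ I)
  let s := hfin.toFinset.image fun P : Ideal R => (P.restrictScalars K).comap E.subtype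
  have hs : (⊤ : Submodule K E) ∉ s := by
    intro h
    obtain ⟨P, hP, hPtop⟩ := Finset.mem_image.1 h
    exact hproper P (hfin.mem_toFinset.1 hP) hPtop
  obtain ⟨l, hl⟩ := (Set.ne_univ_iff_exists_notMem _).1
    (Subspace.biUnion_ne_univ_of_top_notMem hs)
  refine ⟨l, l.2, fun x hx => ?_⟩
  by_contra hxI
  have hmem : (l : R) ∈ ⋃ p ∈ associatedPrimes R (R ⧸ I), (p : Set R) := by
    rw [biUnion_associatedPrimes_eq_zero_divisors]
    refine ⟨Ideal.Quotient.mk I x, fun h => hxI (Ideal.Quotient.eq_zero_iff_mem.1 h), ?_⟩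
    rw [mul_comm] at hx
    exact Ideal.Quotient.eq_zero_iff_mem.2 hx
  obtain ⟨P, hP, hlP⟩ := Set.mem_iUnion₂.1 hmem
  exact hl (Set.mem_iUnion₂.2
    ⟨_, Finset.mem_image_of_mem _ (hfin.mem_toFinset.2 hP), hlP⟩)

lemma monotone_hilbF [Infinite K] {I : Ideal (MvPolynomial (Fin (n + 1)) K)}
    (hhom : I.IsHomogeneous (homogeneousSubmodule (Fin (n + 1)) K)) (hsat : saturate I = I) :
    Monotone (hilbF I) := by
  obtain ⟨l, hl, hreg⟩ := exists_linear_nonzerodivisor hsat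
  have hres : residualIdeal I l = I :=
    le_antisymm (fun x hx => hreg x (Ideal.mem_colon_span_singleton.1 hx)) Ideal.le_colon
  refine monotone_nat_of_le_succ fun m => ?_
  by_cases hl0 : l = 0
  · have htop : I = ⊤ := I.eq_top_iff_one.2 (hreg 1 (by simp [hl0]))
    have h := hilbF_add_finrank_gradedPart I m
    have hpart : gradedPart I m = homogeneousSubmodule (Fin (n + 1)) K m :=
      inf_eq_left.2 fun x _ => htop ▸ Submodule.mem_top
    rw [hpart] at h
    omega
  · have h := hilbF_residualIdeal_add hhom hl0 hl m
    rw [hres] at h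
    omega

lemma exists_saturate_le_colon (I : Ideal (MvPolynomial (Fin (n + 1)) K)) :
    ∃ k, ∀ x ∈ saturate I, ∀ y ∈ irrelevantIdeal K n ^ k, x * y ∈ I := by
  let c : ℕ →o Ideal (MvPolynomial (Fin (n + 1)) K) :=
    ⟨fun k => Submodule.colon I ((irrelevantIdeal K n ^ k : Ideal _) : Set _),
      fun i j hij => Submodule.colon_mono le_rfl (Ideal.pow_le_pow_right hij)⟩
  obtain ⟨k, hk⟩ := WellFoundedGT.monotone_chain_condition c
  refine ⟨k, fun x hx y hy => ?_⟩
  have hle : saturate I ≤ c k := iSup_le fun j => by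
    rcases le_total j k with h | h
    · exact c.monotone h
    · exact (hk j h).ge
  exact Submodule.mem_colon.1 (hle hx) y hy

lemma exists_totalDegree_le_sub_mem (I : Ideal (MvPolynomial (Fin (n + 1)) K)) :
    ∃ N, ∀ x ∈ saturate I, ∃ y, y.totalDegree ≤ N ∧ x - y ∈ I := by
  obtain ⟨k, hk⟩ := exists_saturate_le_colon I
  obtain ⟨s, hs⟩ := (isNoetherian_def.1 (inferInstance : IsNoetherianRing _)) (saturate I)
  refine ⟨k + s.sup totalDegree, fun x hx => ?_⟩
  rw [← hs] at hx
  obtain ⟨a, -, rfl⟩ := Submodule.mem_span_finset.1 hx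
  let low : MvPolynomial (Fin (n + 1)) K → MvPolynomial (Fin (n + 1)) K := fun p =>
    ∑ i ∈ Finset.range k, homogeneousComponent i p
  have hlow : ∀ p, (low p).totalDegree ≤ k := fun p =>
    totalDegree_finsetSum_le fun i hi =>
      (homogeneousComponent_isHomogeneous i p).totalDegree_le.trans (Finset.mem_range.1 hi).le
  have hhigh : ∀ p, p - low p ∈ irrelevantIdeal K n ^ k := fun p => by
    refine (mem_pow_idealOfVars_iff' k _).2 fun e he => ?_
    rw [coeff_sub, coeff_sum]
    simp [coeff_homogeneousComponent, he]
  refine ⟨∑ g ∈ s, low (a g) * g, totalDegree_finsetSum_le fun g hg => ?_, ?_⟩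
  · exact (totalDegree_mul _ _).trans (add_le_add (hlow _) (Finset.le_sup hg))
  · rw [← Finset.sum_sub_distrib]
    refine Ideal.sum_mem _ fun g hg => ?_
    rw [smul_eq_mul, ← sub_mul, mul_comm]
    exact hk g (hs ▸ Submodule.subset_span hg) _ (hhigh _)

lemma eventually_hilbF_saturate {I : Ideal (MvPolynomial (Fin (n + 1)) K)}
    (hI : I.IsHomogeneous (homogeneousSubmodule (Fin (n + 1)) K)) :
    ∀ᶠ m in atTop, hilbF (saturate I) m = hilbF I m := by
  obtain ⟨N, hN⟩ := exists_totalDegree_le_sub_mem I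
  filter_upwards [eventually_gt_atTop N] with m hm
  have hpart : gradedPart (saturate I) m = gradedPart I m := by
    refine le_antisymm ?_ (inf_le_inf_left _ (le_saturate I))
    rintro x ⟨hx, hxs⟩
    refine ⟨hx, ?_⟩
    obtain ⟨y, hy, hxy⟩ := hN x hxs
    have h := homogeneousComponent_mem_of_mem hI hxy m
    rwa [map_sub, homogeneousComponent_eq_self hx,
      homogeneousComponent_eq_zero _ _ (hy.trans_lt hm), sub_zero] at h
  have h1 := hilbF_add_finrank_gradedPart I m
  have h2 := hilbF_add_finrank_gradedPart (saturate I) m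
  rw [hpart] at h2
  omega

lemma schemeDeg_eq {I : Ideal (MvPolynomial (Fin (n + 1)) K)} {d : ℕ}
    (h : ∀ᶠ m in atTop, hilbF I m = d) : schemeDeg I = d := by
  have hex : ∃ d, ∀ᶠ m in atTop, hilbF I m = d := ⟨d, h⟩
  rw [schemeDeg, dif_pos hex]
  obtain ⟨m, hm₁, hm₂⟩ := (hex.choose_spec.and h).exists
  exact hm₁.symm.trans hm₂

lemma eventually_hilbF_of_schemeDeg_pos {I : Ideal (MvPolynomial (Fin (n + 1)) K)}
    (h : 0 < schemeDeg I) : ∀ᶠ m in atTop, hilbF I m = schemeDeg I := by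
  by_cases hex : ∃ d, ∀ᶠ m in atTop, hilbF I m = d
  · rw [schemeDeg, dif_pos hex]
    exact hex.choose_spec
  · rw [schemeDeg, dif_neg hex] at h
    exact absurd h (lt_irrefl 0)

lemma schemeReg_mem {I : Ideal (MvPolynomial (Fin (n + 1)) K)}
    (h : ∀ᶠ m in atTop, hilbF I m = schemeDeg I) :
    1 ≤ schemeReg I ∧ ∀ m, schemeReg I - 1 ≤ m → hilbF I m = schemeDeg I := by
  obtain ⟨N, hN⟩ := eventually_atTop.1 h
  exact Nat.sInf_mem (s := {p : ℕ | 1 ≤ p ∧ ∀ m : ℕ, p - 1 ≤ m → hilbF I m = schemeDeg I})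
    ⟨N + 1, Nat.le_add_left _ _, fun m hm => hN m hm⟩

lemma hilbF_schemeReg_sub_two_ne {I : Ideal (MvPolynomial (Fin (n + 1)) K)}
    (h : ∀ᶠ m in atTop, hilbF I m = schemeDeg I) (h2 : 2 ≤ schemeReg I) :
    hilbF I (schemeReg I - 2) ≠ schemeDeg I := by
  intro heq
  have hmem : schemeReg I - 1 ∈
      {p : ℕ | 1 ≤ p ∧ ∀ m : ℕ, p - 1 ≤ m → hilbF I m = schemeDeg I} := by
    refine ⟨by omega, fun m hm => ?_⟩
    rcases hm.eq_or_lt with rfl | hlt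
    · rwa [Nat.sub_sub]
    · exact (schemeReg_mem h).2 m (by omega)
  have := Nat.sInf_le hmem
  rw [← schemeReg] at this
  omega

lemma ceil_div_add_two_le {n d e : ℕ} (hn : 0 < n) (h : e + (2 * n + 1) ≤ d) :
    ⌈((e : ℚ) - 1) / ((n : ℚ) + (n : ℚ) / (2 * (n : ℚ) + 2))⌉ + 2 ≤
      ⌈((d : ℚ) - 1) / ((n : ℚ) + (n : ℚ) / (2 * (n : ℚ) + 2))⌉ := by
  have hn' : (0 : ℚ) < n := by exact_mod_cast hn
  have h' : (e : ℚ) + (2 * n + 1) ≤ d := by exact_mod_cast h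
  have hlt : (n : ℚ) / (2 * n + 2) ≤ 1 / 2 := by
    rw [div_le_div_iff₀ (by positivity) (by positivity)]
    linarith
  set c : ℚ := (n : ℚ) + (n : ℚ) / (2 * (n : ℚ) + 2) with hc
  have hcpos : 0 < c := by positivity
  rw [show (2 : ℤ) = ((2 : ℕ) : ℤ) from rfl, ← Int.ceil_add_natCast]
  apply Int.ceil_le_ceil
  rw [div_add' _ _ _ hcpos.ne']
  gcongr
  push_cast
  linarith

end HilbertFunction

/-- Lemma 4.2, first part. -/
theorem stmt12 (K : Type) [Field K] [IsAlgClosed K] [CharZero K] (n d : ℕ)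
    (I : Ideal (MvPolynomial (Fin (n+1)) K))
    (hfin : IsFiniteSubscheme I) (hnd : NondegenerateScheme I)
    (hlgp : InLinGenPos I) (hdeg : schemeDeg I = d)
    (hreg : ⌈((d : ℚ) - 1) / ((n : ℚ) + (n : ℚ) / (2*(n : ℚ) + 2))⌉ + 3 ≤ (schemeReg I : ℤ))
    (f : MvPolynomial (Fin (n+1)) K) (hf0 : f ≠ 0) (hfh : f.IsHomogeneous 2)
    (hsec : 2*n + 1 ≤ schemeDeg (interIdeal I (Ideal.span {f})))
    (hregQ : schemeReg (interIdeal I (Ideal.span {f})) < schemeReg I) :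
    ⌈((schemeDeg (residualIdeal I f) : ℚ) - 1) / ((n : ℚ) + (n : ℚ) / (2*(n : ℚ) + 2))⌉ + 3
      ≤ (schemeReg (residualIdeal I f) : ℤ) := by
  have hI : ∀ᶠ m in atTop, hilbF I m = schemeDeg I := by
    obtain ⟨d', -, hd'⟩ := hfin.finite
    rwa [schemeDeg_eq hd']
  have hJ := eventually_hilbF_of_schemeDeg_pos (lt_of_lt_of_le (Nat.succ_pos _) hsec)
  have hhom : (I ⊔ Ideal.span {f}).IsHomogeneous (homogeneousSubmodule (Fin (n + 1)) K) :=
    hfin.homog.sup (Ideal.homogeneous_span _ _ fun x hx => ⟨2, hx ▸ hfh⟩)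
  have hadd := hilbF_residualIdeal_add hfin.homog hf0 hfh
  have hsat : ∀ m, hilbF (interIdeal I (Ideal.span {f})) m ≤ hilbF (I ⊔ Ideal.span {f}) m :=
    hilbF_anti (le_saturate _)
  have hres : ∀ᶠ m in atTop, hilbF (residualIdeal I f) m =
      schemeDeg I - schemeDeg (interIdeal I (Ideal.span {f})) := by
    filter_upwards [(tendsto_add_atTop_nat 2).eventually
      (hI.and (hJ.and (eventually_hilbF_saturate hhom)))] with m hm
    obtain ⟨h1, h2, h3⟩ := hm
    have := hadd m
    rw [interIdeal] at h2 ⊢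
    omega
  have hle : schemeDeg (interIdeal I (Ideal.span {f})) ≤ schemeDeg I := by
    obtain ⟨m, h1, h2⟩ := ((tendsto_add_atTop_nat 2).eventually (hI.and hJ)).exists
    have := hadd m
    have := hsat (m + 2)
    omega
  have hdres := schemeDeg_eq hres
  rw [← hdres] at hres
  have hd1 : 1 ≤ d := by omega
  have hr3 : 3 ≤ schemeReg I := by
    have : (0 : ℤ) ≤ ⌈((d : ℚ) - 1) / ((n : ℚ) + (n : ℚ) / (2 * (n : ℚ) + 2))⌉ := by
      apply Int.ceil_nonneg
      have : (1 : ℚ) ≤ d := by exact_mod_cast hd1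
      apply div_nonneg (by linarith) (by positivity)
    omega
  have hmono := monotone_hilbF hfin.homog hfin.saturated
  have hId : ∀ m, hilbF I m ≤ schemeDeg I := fun m => by
    obtain ⟨k, hk, hmk⟩ := (hI.and (eventually_ge_atTop m)).exists
    exact (hmono hmk).trans_eq hk
  have hne := hilbF_schemeReg_sub_two_ne hI (by omega)
  have hJr := (schemeReg_mem hJ).2 (schemeReg I - 2) (by omega)
  have hn : 0 < n := by
    rcases Nat.eq_zero_or_pos n with rfl | hn
    · have h1 := hilbF_le_one I (schemeReg I - 2)
      have h2 := hilbF_anti (le_sup_left : I ≤ I ⊔ Ideal.span {f}) (schemeReg I - 2)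
      have h3 := hsat (schemeReg I - 2)
      have h4 := hilbF_le_one I (schemeReg I - 1)
      have h5 := (schemeReg_mem hI).2 (schemeReg I - 1) le_rfl
      omega
    · exact hn
  have hr4 : 4 ≤ schemeReg I := by
    by_contra hlt
    have h3 : schemeReg I - 2 = 1 := by omega
    rw [h3] at hJr
    have := hilbF_one_le (interIdeal I (Ideal.span {f}))
    omega
  have hreg' : schemeReg I - 2 ≤ schemeReg (residualIdeal I f) := by
    by_contra hlt
    have h1 := (schemeReg_mem hres).2 (schemeReg I - 4) (by omega)
    have h2 := hadd (schemeReg I - 4)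
    rw [show schemeReg I - 4 + 2 = schemeReg I - 2 by omega] at h2
    have h3 := hsat (schemeReg I - 2)
    have h4 := hId (schemeReg I - 2)
    omega
  have hceil := ceil_div_add_two_le (d := d) (e := schemeDeg (residualIdeal I f)) hn (by omega)
  omega
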